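/- Let L > 1 be a real number and p ≥ 1 an integer such that the continuant c_p of the sequence of p ones satisfies c_p² ≥ log L. Let d₁,…,d_k be positive integers with k ≥ 2p such that d₁ = … = d_p = 1 and d_{k−p+1} = … = d_k = 1. Then |⟨d₂,…,d_k⟩/⟨d₁,…,d_k⟩ − 1/φ| ≤ 2/log L and |⟨d₁,…,d_{k−1}⟩/⟨d₁,…,d_k⟩ − 1/φ| ≤ 2/log L, where φ = (1+√5)/2 is the golden ratio. -/

import Mathlib

/-- Continuant `⟨d₁,…,d_k⟩`. -/
def cont : List ℕ → ℕ
  | [] => 1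
  | [d] => d
  | d :: e :: D => d * cont (e :: D) + cont D

theorem cont_cons {R : List ℕ} (d : ℕ) (hR : R ≠ []) :
    cont (d :: R) = d * cont R + cont R.tail := by
  cases R with
  | nil => exact absurd rfl hR
  | cons e R => rfl

theorem cont_append_pair (D : List ℕ) (e d : ℕ) :
    cont (D ++ [e, d]) = d * cont (D ++ [e]) + cont D := by
  induction D using cont.induct with
  | case1 => simp [cont, mul_comm]
  | case2 a => simp [cont]; ring
  | case3 a b D ih₁ ih₂ =>
    simp only [List.cons_append, cont] at ih₁ ih₂ ⊢
    rw [ih₁, ih₂]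
    ring

theorem cont_reverse (D : List ℕ) : cont D.reverse = cont D := by
  induction D using cont.induct with
  | case1 => rfl
  | case2 a => rfl
  | case3 a b D ih₁ ih₂ =>
    have h : (a :: b :: D).reverse = D.reverse ++ [b, a] := by simp
    have h' : (b :: D).reverse = D.reverse ++ [b] := by simp
    rw [h, cont_append_pair, ← h', ih₁, ih₂, cont]

theorem cont_mul_le_cont_append (A R : List ℕ) : cont A * cont R ≤ cont (A ++ R) := by
  induction A using cont.induct with
  | case1 => simp [cont]
  | case2 a =>
    cases R with
    | nil => simp [cont]
    | cons e R => simp [cont]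
  | case3 a b A ih₁ ih₂ =>
    simp only [List.cons_append, cont] at ih₁ ih₂ ⊢
    nlinarith [Nat.mul_le_mul_left a ih₁]

theorem cont_pos {D : List ℕ} (hD : ∀ d ∈ D, 0 < d) : 0 < cont D := by
  induction D using cont.induct with
  | case1 => simp [cont]
  | case2 a => simpa [cont] using hD
  | case3 a b D ih₁ ih₂ =>
    have := ih₂ fun d hd => hD d (by simp [hd])
    rw [cont]
    omega

theorem cont_tail_le {D : List ℕ} (hD : ∀ d ∈ D, 0 < d) : cont D.tail ≤ cont D := by
  cases D with
  | nil => simp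
  | cons a R =>
    have ha : 0 < a := hD a (by simp)
    rcases eq_or_ne R [] with rfl | hR
    · simpa [cont, Nat.one_le_iff_ne_zero, Nat.pos_iff_ne_zero] using ha
    · rw [cont_cons a hR]
      exact (Nat.le_mul_of_pos_left _ ha).trans (Nat.le_add_right _ _)

theorem cont_tail_sub_mul_cont_replicate_append {t : ℝ} (ht : t ^ 2 = 1 - t) {R : List ℕ}
    (hR : R ≠ []) (n : ℕ) :
    (cont (List.replicate n 1 ++ R).tail : ℝ) - t * cont (List.replicate n 1 ++ R) =
      (-t) ^ n * (cont R.tail - t * cont R) := by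
  induction n with
  | zero => simp
  | succ n ih =>
    rw [List.replicate_succ, List.cons_append, List.tail_cons, cont_cons 1 (by simp [hR]),
      pow_succ', mul_assoc, ← ih]
    push_cast
    linear_combination (-(cont (List.replicate n 1 ++ R) : ℝ)) * ht

theorem pow_mul_cont_replicate_le_one {t : ℝ} (ht₀ : 0 < t) (ht : t ^ 2 = 1 - t) (n : ℕ) :
    t ^ n * cont (List.replicate n 1) ≤ 1 := by
  induction n using Nat.twoStepInduction with
  | zero => simp [cont]
  | one => simp [cont]; nlinarith
  | more n ih₁ ih₂ =>
    have h : cont (List.replicate (n + 2) 1) =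
        cont (List.replicate (n + 1) 1) + cont (List.replicate n 1) := by
      simp [List.replicate_succ, cont]
    rw [h]
    push_cast
    calc t ^ (n + 2) * ((cont (List.replicate (n + 1) 1) : ℝ) + cont (List.replicate n 1))
        = t * (t ^ (n + 1) * cont (List.replicate (n + 1) 1)) +
          t ^ 2 * (t ^ n * cont (List.replicate n 1)) := by ring
      _ ≤ t * 1 + t ^ 2 * 1 := by gcongr
      _ = 1 := by linarith

/-- If `D` starts with `p` ones followed by at least one more term, then
`⟨d₂,…,d_k⟩/⟨d₁,…,d_k⟩` is within `1/c_p²` of the positive root `t` of `t² + t = 1`. -/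
theorem abs_cont_tail_div_sub_le {t : ℝ} (ht₀ : 0 < t) (ht : t ^ 2 = 1 - t) {p : ℕ} {D : List ℕ}
    (hD : ∀ d ∈ D, 0 < d) (hlen : p < D.length) (hfirst : D.take p = List.replicate p 1) :
    |(cont D.tail : ℝ) / cont D - t| ≤ 1 / (cont (List.replicate p 1) : ℝ) ^ 2 := by
  obtain ⟨R, hDR⟩ : ∃ R, D = List.replicate p 1 ++ R :=
    ⟨D.drop p, by rw [← hfirst, List.take_append_drop]⟩
  have hR : R ≠ [] := by
    rintro rfl
    simp [hDR] at hlen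
  have hRpos : ∀ d ∈ R, 0 < d := fun d hd => hD d (by simp [hDR, hd])
  have hDcont : (0 : ℝ) < cont D := mod_cast cont_pos hD
  have hc : (0 : ℝ) < cont (List.replicate p 1) :=
    mod_cast cont_pos fun d hd => by simp [List.eq_of_mem_replicate hd]
  have hRtail : (cont R.tail : ℝ) ≤ cont R := mod_cast cont_tail_le hRpos
  have hmul : (cont (List.replicate p 1) : ℝ) * cont R ≤ cont D := by
    rw [hDR]
    exact mod_cast cont_mul_le_cont_append _ _
  have hR₀ : (0 : ℝ) ≤ cont R := Nat.cast_nonneg _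
  have hRtail₀ : (0 : ℝ) ≤ cont R.tail := Nat.cast_nonneg _
  have hdiff : |(cont D.tail : ℝ) - t * cont D| ≤ t ^ p * cont R := by
    rw [hDR, cont_tail_sub_mul_cont_replicate_append ht hR, abs_mul, abs_pow, abs_neg,
      abs_of_pos ht₀]
    gcongr
    rw [abs_le]
    constructor <;> nlinarith
  have heq : (cont D.tail : ℝ) / cont D - t = ((cont D.tail : ℝ) - t * cont D) / cont D := by
    field_simp
  rw [heq, abs_div, abs_of_pos hDcont, div_le_div_iff₀ hDcont (by positivity), one_mul]
  calc |(cont D.tail : ℝ) - t * cont D| * (cont (List.replicate p 1) : ℝ) ^ 2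
      ≤ t ^ p * cont R * (cont (List.replicate p 1) : ℝ) ^ 2 := by gcongr
    _ = (t ^ p * cont (List.replicate p 1)) * (cont (List.replicate p 1) * cont R) := by ring
    _ ≤ 1 * cont D := by
      gcongr
      exact pow_mul_cont_replicate_le_one ht₀ ht p
    _ = cont D := one_mul _

/-- if the first and last `p` partial quotients of `D` are equal to `1`
and the continuant of `p` ones satisfies `c_p² ≥ log L`, then the ratios
`⟨d₂,…,d_k⟩/⟨d₁,…,d_k⟩` and `⟨d₁,…,d_{k−1}⟩/⟨d₁,…,d_k⟩` are within `2/log L`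
of `1/φ`, where `φ = (1+√5)/2`. -/
theorem continuant_ratio_near_golden (L : ℝ) (hL : 1 < L)
    (p : ℕ) (hp : 1 ≤ p)
    (hcp : Real.log L ≤ ((cont (List.replicate p 1) : ℝ)) ^ 2)
    (D : List ℕ) (hpos : ∀ d ∈ D, 0 < d) (hlen : 2 * p ≤ D.length)
    (hfirst : D.take p = List.replicate p 1)
    (hlast : D.drop (D.length - p) = List.replicate p 1) :
    |(cont D.tail : ℝ) / (cont D : ℝ) - 1 / ((1 + Real.sqrt 5) / 2)| ≤ 2 / Real.log L ∧
    |(cont D.dropLast : ℝ) / (cont D : ℝ) - 1 / ((1 + Real.sqrt 5) / 2)| ≤ 2 / Real.log L := by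
  have ht₀ : 0 < 1 / ((1 + Real.sqrt 5) / 2) := by positivity
  have ht : (1 / ((1 + Real.sqrt 5) / 2)) ^ 2 = 1 - 1 / ((1 + Real.sqrt 5) / 2) := by
    have h5 : Real.sqrt 5 ^ 2 = 5 := Real.sq_sqrt (by norm_num)
    field_simp
    linear_combination -h5
  have hlog : 0 < Real.log L := Real.log_pos hL
  have hbound : 1 / (cont (List.replicate p 1) : ℝ) ^ 2 ≤ 2 / Real.log L :=
    div_le_div₀ (by norm_num) (by norm_num) hlog hcp
  have hrev : D.reverse.take p = List.replicate p 1 := by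
    rw [List.take_reverse, hlast, List.reverse_replicate]
  have hdrop : cont D.dropLast = cont D.reverse.tail := by
    rw [List.tail_reverse, cont_reverse]
  refine ⟨(abs_cont_tail_div_sub_le ht₀ ht hpos (by omega) hfirst).trans hbound, ?_⟩
  rw [hdrop, ← cont_reverse D]
  refine (abs_cont_tail_div_sub_le ht₀ ht ?_ ?_ hrev).trans hbound
  · simpa using hpos
  · rw [List.length_reverse]
    omega
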